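/- For every n ∈ ℕ, all x, y ∈ ℤ, and every A ∈ ℤ*: (0^{2n+1}, x, A) ~ (0^{2n+1}, y, A), where 0^{2n+1} denotes 2n+1 copies of 0 and commas denote concatenation. -/

import Mathlib

/-- `Y` is a blowing-up of the finite integer sequence `X`. -/
inductive SeqBlowup : List ℤ → List ℤ → Prop
  | empty : SeqBlowup [] [-1]
  | left (x : ℤ) (l : List ℤ) : SeqBlowup (x :: l) (-1 :: (x - 1) :: l)
  | mid (A B : List ℤ) (a b : ℤ) :
      SeqBlowup (A ++ a :: b :: B) (A ++ (a - 1) :: -1 :: (b - 1) :: B)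
  | right (l : List ℤ) (x : ℤ) : SeqBlowup (l ++ [x]) (l ++ [x - 1, -1])

/-- Two sequences are equivalent if one is obtained from the other by a finite
sequence of blowings-up and blowings-down. -/
def SeqEquiv (X Y : List ℤ) : Prop := Relation.EqvGen SeqBlowup X Y

namespace SeqEquiv

theorem of_succ {f : ℤ → List ℤ} (h : ∀ x, SeqEquiv (f x) (f (x + 1))) (x y : ℤ) :
    SeqEquiv (f x) (f y) := by
  have key : ∀ z, SeqEquiv (f 0) (f z) := by
    intro z
    induction z using Int.induction_on with
    | zero => exact .refl _
    | succ i ih => exact .trans _ _ _ ih (h _)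
    | pred i ih =>
      have hi := h (-(i : ℤ) - 1)
      rw [sub_add_cancel] at hi
      exact .trans _ _ _ ih (.symm _ _ hi)
  exact .trans _ _ _ (.symm _ _ (key x)) (key y)

theorem zero_cons_succ (x : ℤ) (A : List ℤ) : SeqEquiv (0 :: x :: A) (0 :: (x + 1) :: A) := by
  have h₁ := SeqBlowup.left 0 (x :: A)
  have h₂ := SeqBlowup.mid [] A 0 (x + 1)
  simp only [zero_sub, add_sub_cancel_right, List.nil_append] at h₁ h₂
  exact .trans _ _ _ (.rel _ _ h₁) (.symm _ _ (.rel _ _ h₂))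

theorem shift_across_zero (P A : List ℤ) (a b : ℤ) :
    SeqEquiv (P ++ a :: 0 :: b :: A) (P ++ (a - 1) :: 0 :: (b + 1) :: A) := by
  have h₁ := SeqBlowup.mid P (b :: A) a 0
  have h₂ := SeqBlowup.mid (P ++ [a - 1]) A 0 (b + 1)
  simp only [zero_sub, add_sub_cancel_right, List.append_assoc, List.cons_append,
    List.nil_append] at h₁ h₂
  exact .trans _ _ _ (.rel _ _ h₁) (.symm _ _ (.rel _ _ h₂))

end SeqEquiv

/-- **Lemma.** `(0^{2n+1}, x, A) ~ (0^{2n+1}, y, A)`. -/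
theorem seqEquiv_change_after_odd_zeros (n : ℕ) (x y : ℤ) (A : List ℤ) :
    SeqEquiv (List.replicate (2 * n + 1) 0 ++ x :: A)
      (List.replicate (2 * n + 1) 0 ++ y :: A) := by
  induction n generalizing x y A with
  | zero =>
    exact SeqEquiv.of_succ (f := fun z => 0 :: z :: A)
      (fun z => SeqEquiv.zero_cons_succ z A) x y
  | succ n ih =>
    have append_zeros : ∀ z : ℤ, List.replicate (2 * (n + 1) + 1) 0 ++ z :: A =
        List.replicate (2 * n + 1) 0 ++ 0 :: 0 :: z :: A := by
      intro z
      rw [show 2 * (n + 1) + 1 = (2 * n + 1) + 2 by ring, List.replicate_add,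
        List.append_assoc]
      rfl
    rw [append_zeros, append_zeros]
    exact SeqEquiv.of_succ (f := fun z => List.replicate (2 * n + 1) 0 ++ 0 :: 0 :: z :: A)
      (fun z => .trans _ _ _ (SeqEquiv.shift_across_zero _ A 0 z) (ih _ _ _)) x y
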